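/- Assume T = Σ_{(u,v)∈E} A(u,v) > 0, and let ν be the probability distribution on E that picks edge (u,v) with probability A(u,v)/T, independently of g ∼ μ. Then for every seed set S ⊆ V: δ_L(S) = T · Pr_{g∼μ, (u,v)∼ν}[ S ∩ (R_{g^T}(u) ∩ R_{g^T}(v)) ≠ ∅ ]. -/

import Mathlib

open scoped Classical
open Finset

noncomputable section

/-- The set of vertices reachable from the seed set `S` along edges of `g`. -/
def reach {V : Type*} [Fintype V] (g : Finset (V × V)) (S : Finset V) : Finset V :=
  Finset.univ.filter fun v => ∃ u ∈ S, Relation.ReflTransGen (fun a b => (a, b) ∈ g) u v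

/-- The transpose graph `g^T`: `(u,v) ∈ g` iff `(v,u) ∈ g^T`. -/
def transpose {V : Type*} (g : Finset (V × V)) : Finset (V × V) := g.image Prod.swap

/-- The lower bound `δ_L(S)`: only edges whose two endpoints are reachable
from the same seed node are counted. -/
def deltaL {V : Type*} [Fintype V] (E : Finset (V × V)) (A : V × V → ℝ)
    (μ : Finset (V × V) → ℝ) (S : Finset V) : ℝ :=
  ∑ g ∈ E.powerset, μ g *
    ∑ e ∈ E.filter (fun e => ∃ x ∈ S, e.1 ∈ reach g {x} ∧ e.2 ∈ reach g {x}), A e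

theorem mem_transpose {V : Type*} (g : Finset (V × V)) (a b : V) :
    (a, b) ∈ transpose g ↔ (b, a) ∈ g := by
  simp [transpose]

/-- `x` is reverse reachable from `v` exactly when `v` is reachable from `x`. -/
theorem mem_reach_transpose_singleton {V : Type*} [Fintype V] (g : Finset (V × V)) (x v : V) :
    x ∈ reach (transpose g) {v} ↔ v ∈ reach g {x} := by
  simp only [reach, mem_filter, mem_univ, true_and, mem_singleton, exists_eq_left, mem_transpose]
  exact Relation.reflTransGen_swap (r := fun a b => (a, b) ∈ g)

/-- A seed set meets the common reverse reachable set of `u` and `v` exactly when some seed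
reaches both. -/
theorem inter_reach_transpose_nonempty_iff {V : Type*} [Fintype V] (g : Finset (V × V))
    (S : Finset V) (u v : V) :
    (S ∩ (reach (transpose g) {u} ∩ reach (transpose g) {v})).Nonempty ↔
      ∃ x ∈ S, u ∈ reach g {x} ∧ v ∈ reach g {x} := by
  simp only [Finset.Nonempty, mem_inter, mem_reach_transpose_singleton]

/-- `δ_L(S) = T · Pr_{g∼μ,(u,v)∼ν}[S ∩ (R_{g^T}(u) ∩ R_{g^T}(v)) ≠ ∅]`,
where `ν` picks edge `(u,v)` with probability `A(u,v)/T` and `T = Σ_{(u,v)∈E} A(u,v)`. -/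
theorem deltaL_eq_T_mul_prob {V : Type*} [Fintype V]
    (E : Finset (V × V)) (A : V × V → ℝ) (μ : Finset (V × V) → ℝ)
    (hA : ∀ e ∈ E, 0 ≤ A e) (hA0 : ∀ e ∉ E, A e = 0)
    (hμ : ∀ g ∈ E.powerset, 0 ≤ μ g) (hμ1 : ∑ g ∈ E.powerset, μ g = 1)
    (hT : 0 < ∑ e ∈ E, A e)
    (S : Finset V) :
    deltaL E A μ S = (∑ e ∈ E, A e) *
      ∑ g ∈ E.powerset, ∑ e ∈ E.filter (fun e =>
          (S ∩ (reach (transpose g) {e.1} ∩ reach (transpose g) {e.2})).Nonempty),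
        μ g * (A e / ∑ e' ∈ E, A e') := by
  simp only [inter_reach_transpose_nonempty_iff, deltaL, mul_sum]
  refine sum_congr rfl fun g _ => sum_congr rfl fun e _ => ?_
  field_simp [hT.ne']
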